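/- arXiv:2601.22176 — 9 statements merged into one kernel-verified Lean document; each statement's English description precedes it below -/
import Mathlib

section
/- Let n be a positive natural number, t : ZMod n, and let s : Fin n ≃ ZMod n be a series with s 0 = 0. Let B be the series obtained from s by retrograde inversion with transposition t, i.e. B i = t − s (rev i). Let C be the series obtained from B by inversion-after-retrogradation with transposition −t, i.e. C i = 2 · B (rev 0) − B (rev i) + (−t). Then C = s; consequently, the proliferating permutation τ = C ∘ B.symm obtained from B equals σ⁻¹, the inverse of the proliferating permutation σ = B ∘ s.symm obtained from s. -/
/-- applying retrograde inversion with transposition `t` and then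
inversion-after-retrogradation with transposition `-t` returns the original series;
hence the PP obtained from `B` is the inverse of the PP obtained from `s`. -/
theorem stmt_2 (n : ℕ) [NeZero n] (t : ZMod n) (s : Fin n ≃ ZMod n) (hs : s 0 = 0)
    (B : Fin n ≃ ZMod n) (hB : ∀ i : Fin n, B i = t - s i.rev)
    (C : Fin n ≃ ZMod n) (hC : ∀ i : Fin n, C i = 2 * B (Fin.rev 0) - B i.rev + (-t))
    (σ : Equiv.Perm (ZMod n)) (hσ : ∀ x : ZMod n, σ x = B (s.symm x))
    (τ : Equiv.Perm (ZMod n)) (hτ : ∀ x : ZMod n, τ x = C (B.symm x)) :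
    C = s ∧ τ = σ⁻¹ := by
  have hCs : C = s := by
    ext i
    rw [hC, hB, hB, Fin.rev_rev, Fin.rev_rev, hs]
    ring
  refine ⟨hCs, eq_inv_of_mul_eq_one_left (Equiv.ext fun x => ?_)⟩
  rw [Equiv.Perm.mul_apply, hτ, hσ, hCs, Equiv.symm_apply_apply, Equiv.apply_symm_apply,
    Equiv.Perm.one_apply]
end

section
/- Let n be a positive natural number, t : ZMod n, and let s : Fin n ≃ ZMod n be a series with s 0 = 0. Let σ be the proliferating permutation of s under retrograde inversion with transposition t, and let ι be the involution of ZMod n given by ι x = t − x. Then ι ∘ σ ∘ ι = σ⁻¹. In particular, for every cycle (a b c …) of σ, the tuple (… ι c, ι b, ι a) is also a cycle of σ. -/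
/-- conjugating the RI proliferating permutation by the involution
`ι x = t - x` gives its inverse; in particular `ι` maps cycles of `σ` to cycles of `σ`. -/
theorem stmt_3 (n : ℕ) [NeZero n] (t : ZMod n) (s : Fin n ≃ ZMod n) (hs : s 0 = 0)
    (σ : Equiv.Perm (ZMod n)) (hσ : ∀ x : ZMod n, σ x = t - s (Fin.rev (s.symm x)))
    (ι : Equiv.Perm (ZMod n)) (hι : ∀ x : ZMod n, ι x = t - x) :
    ι * σ * ι = σ⁻¹ ∧ ∀ a b : ZMod n, σ.SameCycle a b → σ.SameCycle (ι a) (ι b) := by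
  have hιι : ι⁻¹ = ι := by
    rw [inv_eq_iff_mul_eq_one]
    ext x
    simp [hι]
  have hconj : ι * σ * ι = σ⁻¹ := by
    rw [eq_inv_iff_mul_eq_one]
    ext x
    simp [hι, hσ]
  refine ⟨hconj, fun a b hab => ?_⟩
  have h : (ι * σ * ι⁻¹).SameCycle a b := by
    rwa [hιι, hconj, Equiv.Perm.sameCycle_inv]
  rwa [Equiv.Perm.sameCycle_conj, hιι] at h
end

section
/- Let n be a positive even natural number and t : ZMod n with t.val odd, and let s : Fin n ≃ ZMod n be a series with s 0 = 0. Let σ be the proliferating permutation of s under retrograde inversion with transposition t. Then for every x : ZMod n, the points x and t − x do not lie in the same cycle of σ, i.e. ¬ σ.SameCycle x (t − x). -/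
/-- If `a` and `b` are involutions without fixed points, then `x` and `a x` lie in different
cycles of `a * b`. -/
theorem Equiv.Perm.not_sameCycle_mul_of_involutive {α : Type*} (a b : Equiv.Perm α)
    (ha : a * a = 1) (hb : b * b = 1) (ha' : ∀ x, a x ≠ x) (hb' : ∀ x, b x ≠ x) (x : α) :
    ¬ (a * b).SameCycle x (a x) := by
  have hconj : SemiconjBy a (a * b) (a * b)⁻¹ := by
    rw [SemiconjBy, mul_inv_rev, inv_eq_of_mul_eq_one_left ha, inv_eq_of_mul_eq_one_left hb,
      ← mul_assoc, ha, mul_assoc, ha, one_mul, mul_one]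
  have hpow (m : ℤ) (y : α) : ((a * b) ^ (-m)) (a y) = a (((a * b) ^ m) y) := by
    have h := (hconj.zpow_right m).eq
    rw [inv_zpow'] at h
    exact (DFunLike.congr_fun h y).symm
  rintro ⟨k, hk⟩
  obtain ⟨m, rfl | rfl⟩ := Int.even_or_odd' k
  · apply ha' (((a * b) ^ m) x)
    rw [← hpow, ← hk, ← Equiv.Perm.mul_apply, ← zpow_add]
    congr 2
    ring
  · apply hb' (((a * b) ^ m) x)
    apply a.injective
    rw [← hpow, ← hk, ← Equiv.Perm.mul_apply a b, ← Equiv.Perm.mul_apply,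
      ← Equiv.Perm.mul_apply, ← zpow_add, ← zpow_one_add]
    congr 2
    ring

theorem ZMod.add_self_ne_of_odd_val {n : ℕ} [NeZero n] (hn : Even n) {t : ZMod n}
    (ht : Odd t.val) (x : ZMod n) : x + x ≠ t := by
  rintro rfl
  rw [ZMod.val_add] at ht
  have := (Even.mod_even_iff hn).2 (Even.add_self x.val)
  exact Nat.not_even_iff_odd.2 ht this

theorem Fin.rev_ne_of_even {n : ℕ} (hn : Even n) (i : Fin n) : i.rev ≠ i := by
  intro h
  have := congrArg Fin.val h
  rw [Fin.val_rev] at this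
  obtain ⟨m, rfl⟩ := hn
  omega

/-- for `n` even and `t.val` odd, a point `x` and its inverse `t - x`
never lie in the same cycle of the RI proliferating permutation. -/
theorem stmt_4 (n : ℕ) [NeZero n] (hn : Even n) (t : ZMod n) (ht : Odd t.val)
    (s : Fin n ≃ ZMod n) (hs : s 0 = 0)
    (σ : Equiv.Perm (ZMod n)) (hσ : ∀ x : ZMod n, σ x = t - s (Fin.rev (s.symm x))) :
    ∀ x : ZMod n, ¬ σ.SameCycle x (t - x) := by
  intro x
  have hσ' : σ = Equiv.subLeft t * s.permCongr Fin.revPerm := by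
    ext y
    simp [hσ]
  rw [hσ']
  refine Equiv.Perm.not_sameCycle_mul_of_involutive _ _ ?_ ?_ ?_ ?_ x
  · ext y
    simp
  · ext y
    simp
  · intro y hy
    exact ZMod.add_self_ne_of_odd_val hn ht y (sub_eq_iff_eq_add.1 hy).symm
  · intro y hy
    apply Fin.rev_ne_of_even hn (s.symm y)
    apply s.injective
    simpa using hy
end

section
/- Let n be a positive even natural number and t : ZMod n with t.val odd. Then for every multiset μ of positive natural numbers with μ.sum = n / 2, there exists a series s : Fin n ≃ ZMod n with s 0 = 0 such that the full cycle type of the proliferating permutation of s under retrograde inversion with transposition t equals μ + μ. In other words, every doubled multiset summing to n is realized as the cycle structure of some proliferating permutation in this case. -/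
/-- The full cycle type of a permutation: the multiset of the sizes of all its orbits,
with fixed points counted as orbits of size 1. -/
def fullCycleType {α : Type*} [Fintype α] [DecidableEq α] (σ : Equiv.Perm α) : Multiset ℕ :=
  σ.cycleType + Multiset.replicate (Finset.univ.filter fun x => σ x = x).card 1

/-- The proliferating permutation of a series `s` under retrograde inversion with
transposition `t`: `x ↦ t - s (rev (s.symm x))`. -/
def ppRI {n : ℕ} [NeZero n] (t : ZMod n) (s : Fin n ≃ ZMod n) : Equiv.Perm (ZMod n) :=
  (s.symm.trans (Fin.revPerm.trans s)).trans (Equiv.subLeft t)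

namespace Equiv.Perm

/-- The centralizer of a fixed-point-free involution acts transitively. -/
theorem exists_commute_apply_eq {α : Type*} [DecidableEq α] (f : Perm α) (hf : ∀ x, f (f x) = x)
    (hf' : ∀ x, f x ≠ x) (a b : α) : ∃ h : Perm α, (∀ x, h (f x) = f (h x)) ∧ h a = b := by
  by_cases hab : f a = b
  · exact ⟨f, fun _ => rfl, hab⟩
  · have hba : f b ≠ a := fun h => hab (by rw [← h, hf])
    refine ⟨swap a b * swap (f a) (f b), fun x => ?_, ?_⟩
    · have h1 : (f * swap a b * f⁻¹) = swap (f a) (f b) := (swap_apply_apply f a b).symm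
      have h2 : (f * swap (f a) (f b) * f⁻¹) = swap a b := by
        rw [← swap_apply_apply, hf, hf]
      have hd : Commute (swap a b) (swap (f a) (f b)) := by
        rcases eq_or_ne a b with rfl | hne
        · simp
        · refine Disjoint.commute (disjoint_swap_swap ?_)
          have := hf' a
          have := hf' b
          have := f.injective.ne hne
          simp only [List.nodup_cons, List.mem_cons, List.not_mem_nil, List.nodup_nil]
          grind
      have h3 : f * (swap a b * swap (f a) (f b)) * f⁻¹ = swap a b * swap (f a) (f b) := by
        calc _ = (f * swap a b * f⁻¹) * (f * swap (f a) (f b) * f⁻¹) := by group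
          _ = _ := by rw [h1, h2, hd.eq]
      have h4 := mul_inv_eq_iff_eq_mul.1 h3
      exact (DFunLike.congr_fun h4 x).symm
    · have := hf' a
      rw [mul_apply, swap_apply_of_ne_of_ne (this ·.symm) (hba ·.symm), swap_apply_left]

variable {α β : Type*} [Fintype α] [DecidableEq α] [Fintype β] [DecidableEq β]

theorem cycleType_permCongr (e : α ≃ β) (f : Perm α) :
    (e.permCongr f).cycleType = f.cycleType := by
  have h : e.permCongr f =
      f.extendDomain (e.trans (Equiv.subtypeUnivEquiv (p := fun _ : β => True)
        fun _ => trivial).symm) := by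
    ext x
    rw [extendDomain_apply_subtype f _ (b := x) trivial]
    simp [Equiv.permCongr_apply]
  rw [h, cycleType_extendDomain]

theorem cycleType_sumCongr_one (f : Perm α) :
    (sumCongr f (1 : Perm β)).cycleType = f.cycleType := by
  have h : sumCongr f (1 : Perm β) =
      f.extendDomain (Equiv.ofInjective (Sum.inl : α → α ⊕ β) Sum.inl_injective) := by
    ext x
    rcases x with a | b
    · exact (extendDomain_apply_image f
        (Equiv.ofInjective (Sum.inl : α → α ⊕ β) Sum.inl_injective) a).symm
    · rw [extendDomain_apply_not_subtype _ _ (by simp)]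
      simp
  rw [h, cycleType_extendDomain]

theorem cycleType_one_sumCongr (g : Perm β) :
    (sumCongr (1 : Perm α) g).cycleType = g.cycleType := by
  have h : sumCongr (1 : Perm α) g = (Equiv.sumComm β α).permCongr (sumCongr g 1) := by
    ext x
    rcases x with a | b <;> simp [Equiv.permCongr_apply]
  rw [h, cycleType_permCongr, cycleType_sumCongr_one]

theorem cycleType_sumCongr (f : Perm α) (g : Perm β) :
    (sumCongr f g).cycleType = f.cycleType + g.cycleType := by
  have h : sumCongr f g = sumCongr f 1 * sumCongr 1 g := by simp
  have hd : Disjoint (sumCongr f (1 : Perm β)) (sumCongr (1 : Perm α) g) := by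
    rintro (a | b) <;> simp
  rw [h, hd.cycleType_mul, cycleType_sumCongr_one, cycleType_one_sumCongr]

theorem cycleType_of_fixedPointFree_involution (f : Perm α) (hf : ∀ x, f (f x) = x)
    (hf' : ∀ x, f x ≠ x) : f.cycleType = Multiset.replicate (Fintype.card α / 2) 2 := by
  have h2 : f ^ 2 = 1 := by
    ext x
    simp [sq, hf]
  have h := cycleType_of_pow_prime_eq_one h2
  have hsupp : f.support = Finset.univ := by
    ext x
    simp [hf']
  have hs := f.sum_cycleType
  rw [h, hsupp, Finset.card_univ, Multiset.sum_replicate, smul_eq_mul] at hs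
  rw [h, ← hs]
  simp

/-- Two fixed-point-free involutions on sets of equal size are isomorphic, and the isomorphism
can be chosen to match given base points. -/
theorem exists_equiv_intertwining (e₀ : α ≃ β) (f : Perm α) (g : Perm β)
    (hf : ∀ x, f (f x) = x) (hf' : ∀ x, f x ≠ x) (hg : ∀ x, g (g x) = x)
    (hg' : ∀ x, g x ≠ x) (a : α) (b : β) :
    ∃ e : α ≃ β, (∀ x, e (f x) = g (e x)) ∧ e a = b := by
  have hc : IsConj (e₀.permCongr f) g := by
    rw [isConj_iff_cycleType_eq, cycleType_permCongr,
      cycleType_of_fixedPointFree_involution f hf hf',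
      cycleType_of_fixedPointFree_involution g hg hg', Fintype.card_congr e₀]
  obtain ⟨c, hc⟩ := isConj_iff.1 hc
  obtain ⟨h, hcomm, hab⟩ := exists_commute_apply_eq g hg hg' (c (e₀ a)) b
  refine ⟨e₀.trans (c.trans h), fun x => ?_, hab⟩
  have := DFunLike.congr_fun (mul_inv_eq_iff_eq_mul.1 hc) (e₀ x)
  simp only [mul_apply, Equiv.permCongr_apply, Equiv.symm_apply_apply] at this
  simp [this, hcomm]

end Equiv.Perm

theorem fullCycleType_eq {α : Type*} [Fintype α] [DecidableEq α] (σ : Equiv.Perm α) :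
    fullCycleType σ =
      σ.cycleType + Multiset.replicate (Fintype.card α - σ.cycleType.sum) 1 := by
  have h : (Finset.univ.filter fun x => σ x = x) = σ.supportᶜ := by
    ext x
    simp
  rw [fullCycleType, h, Finset.card_compl, Equiv.Perm.sum_cycleType]

theorem exists_fullCycleType_eq {α : Type*} [Fintype α] [DecidableEq α] (μ : Multiset ℕ)
    (hμ : ∀ c ∈ μ, 0 < c) (hsum : μ.sum = Fintype.card α) :
    ∃ π : Equiv.Perm α, fullCycleType π = μ := by
  have hsplit : μ = μ.filter (2 ≤ ·) + Multiset.replicate (μ.filter (¬ 2 ≤ ·)).card 1 := by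
    conv_lhs => rw [← Multiset.filter_add_not (2 ≤ ·) μ]
    congr 1
    refine Multiset.eq_replicate_card.2 fun c hc => ?_
    have := Multiset.mem_filter.1 hc
    have := hμ c this.1
    lia
  have hs := congrArg Multiset.sum hsplit
  rw [Multiset.sum_add, Multiset.sum_replicate, smul_eq_mul, mul_one] at hs
  obtain ⟨π, hπ⟩ := (Equiv.Perm.exists_with_cycleType_iff α (m := μ.filter (2 ≤ ·))).2
    ⟨by lia, fun c hc => (Multiset.mem_filter.1 hc).2⟩
  refine ⟨π, ?_⟩
  rw [fullCycleType_eq, hπ]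
  conv_rhs => rw [hsplit]
  congr 2
  lia

theorem fullCycleType_permCongr {α β : Type*} [Fintype α] [DecidableEq α] [Fintype β]
    [DecidableEq β] (e : α ≃ β) (f : Equiv.Perm α) :
    fullCycleType (e.permCongr f) = fullCycleType f := by
  rw [fullCycleType_eq, fullCycleType_eq, Equiv.Perm.cycleType_permCongr, Fintype.card_congr e]

theorem fullCycleType_sumCongr_inv {α : Type*} [Fintype α] [DecidableEq α]
    (π : Equiv.Perm α) :
    fullCycleType (Equiv.Perm.sumCongr π π⁻¹) = fullCycleType π + fullCycleType π := by
  have h := π.sum_cycleType_le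
  simp only [fullCycleType_eq, Equiv.Perm.cycleType_sumCongr, Equiv.Perm.cycleType_inv,
    Fintype.card_sum, Multiset.sum_add]
  rw [add_add_add_comm, ← Multiset.replicate_add]
  congr 2
  lia

theorem ZMod.sub_ne_self_of_odd_val {n : ℕ} [NeZero n] (hn : Even n) {t : ZMod n}
    (ht : Odd t.val) (x : ZMod n) : t - x ≠ x := by
  intro h
  have hx : t = x + x := sub_eq_iff_eq_add.1 h
  rw [hx, ZMod.val_add] at ht
  exact Nat.not_even_iff_odd.2 ht ((Even.mod_even_iff hn).2 (Even.add_self _))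

/-- for `n` even and `t.val` odd, every doubled multiset `μ + μ`
with `μ.sum = n / 2` is realized as the full cycle type of the RI proliferating
permutation of some series. -/
theorem stmt_6 (n : ℕ) [NeZero n] (hn : Even n) (t : ZMod n) (ht : Odd t.val)
    (μ : Multiset ℕ) (hμ : ∀ c ∈ μ, 0 < c) (hsum : μ.sum = n / 2) :
    ∃ s : Fin n ≃ ZMod n, s 0 = 0 ∧ fullCycleType (ppRI t s) = μ + μ := by
  obtain ⟨m, rfl⟩ := hn
  have hm : (m + m) / 2 = m := by lia
  obtain ⟨π, hπ⟩ := exists_fullCycleType_eq (α := Fin m) μ hμ (by simpa [hm] using hsum)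
  let e₀ : ZMod (m + m) ≃ Fin m ⊕ Fin m := Fintype.equivOfCardEq (by simp [ZMod.card])
  let e₁ : Fin (m + m) ≃ Fin m ⊕ Fin m := Fintype.equivOfCardEq (by simp)
  let ρ : Equiv.Perm (Fin m ⊕ Fin m) :=
    (Equiv.Perm.sumCongr π π⁻¹).trans (Equiv.sumComm (Fin m) (Fin m))
  obtain ⟨e, he, -⟩ := Equiv.Perm.exists_equiv_intertwining e₀ (Equiv.subLeft t)
    (Equiv.sumComm (Fin m) (Fin m)) (by simp)
    (fun x => ZMod.sub_ne_self_of_odd_val ⟨m, rfl⟩ ht x) (by simp)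
    (by rintro (a | a) <;> simp) 0 (e₀ 0)
  obtain ⟨s, hs, hs0⟩ := Equiv.Perm.exists_equiv_intertwining e₁ Fin.revPerm ρ (by simp)
    (by intro x h; simp [Fin.ext_iff, Fin.val_rev] at h; lia)
    (by rintro (a | a) <;> simp [ρ]) (by rintro (a | a) <;> simp [ρ]) 0 (e 0)
  refine ⟨s.trans e.symm, by simp [hs0], ?_⟩
  have hσ : ppRI t (s.trans e.symm) = e.symm.permCongr (Equiv.Perm.sumCongr π π⁻¹) := by
    ext1 x
    apply e.injective
    change e (Equiv.subLeft t (e.symm (s (Fin.revPerm (s.symm (e x)))))) = _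
    rw [he, e.apply_symm_apply, hs, s.apply_symm_apply]
    simp [ρ, Equiv.permCongr_apply]
  rw [hσ, fullCycleType_permCongr, fullCycleType_sumCongr_inv, hπ]
end

section
/- Let n be a positive even natural number and t : ZMod n with t.val even, and let s : Fin n ≃ ZMod n be a series with s 0 = 0. Let σ be the proliferating permutation of s under retrograde inversion with transposition t, and let a, b be the two distinct solutions in ZMod n of x + x = t. Then a and b lie in the same cycle of σ (σ.SameCycle a b), the σ-orbit of a has even size k, and there exists a multiset μ of positive natural numbers with k + 2 · μ.sum = n such that the full cycle type of σ equals k ::ₘ (μ + μ). -/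
/-- A fixed-point-free involution on a finset along which `g` is invariant makes every value
of `g` occur an even number of times. -/
theorem exists_map_eq_add_self_of_involution {β γ : Type*} [DecidableEq β] (f : β → β)
    (g : β → γ) (S : Finset β) (hmem : ∀ x ∈ S, f x ∈ S) (hne : ∀ x ∈ S, f x ≠ x)
    (hinv : ∀ x ∈ S, f (f x) = x) (hg : ∀ x ∈ S, g (f x) = g x) :
    ∃ μ : Multiset γ, S.val.map g = μ + μ := by
  induction S using Finset.strongInduction with
  | H S ih =>
    rcases S.eq_empty_or_nonempty with rfl | ⟨x, hx⟩
    · exact ⟨0, rfl⟩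
    · have hfx : f x ∈ S.erase x := Finset.mem_erase.2 ⟨hne x hx, hmem x hx⟩
      have hsub : ∀ y ∈ (S.erase x).erase (f x), y ∈ S := fun y hy =>
        Finset.mem_of_mem_erase (Finset.mem_of_mem_erase hy)
      obtain ⟨μ, hμ⟩ := ih ((S.erase x).erase (f x))
        ((Finset.erase_ssubset hfx).trans (Finset.erase_ssubset hx))
        (fun y hy => by
          have hyS := hsub y hy
          simp only [Finset.mem_erase] at hy ⊢
          refine ⟨fun h => hy.2.1 ?_, fun h => hy.1 ?_, hmem y hyS⟩
          · rw [← hinv y hyS, h, hinv x hx]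
          · rw [← hinv y hyS, h])
        (fun y hy => hne y (hsub y hy)) (fun y hy => hinv y (hsub y hy))
        (fun y hy => hg y (hsub y hy))
      refine ⟨g x ::ₘ μ, ?_⟩
      rw [← Finset.insert_erase hx, Finset.insert_val_of_notMem (Finset.notMem_erase _ _),
        Multiset.map_cons, ← Finset.insert_erase hfx,
        Finset.insert_val_of_notMem (Finset.notMem_erase _ _), Multiset.map_cons, hμ, hg x hx,
        Multiset.cons_add, Multiset.add_cons]

theorem sum_fullCycleType {α : Type*} [Fintype α] [DecidableEq α] (σ : Equiv.Perm α) :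
    (fullCycleType σ).sum = Fintype.card α := by
  rw [fullCycleType, Multiset.sum_add, Equiv.Perm.sum_cycleType, Multiset.sum_replicate,
    smul_eq_mul, mul_one, ← Finset.card_univ,
    ← Finset.card_filter_add_card_filter_not (s := Finset.univ) (fun x => σ x = x), add_comm]
  rfl

theorem pos_of_mem_fullCycleType {α : Type*} [Fintype α] [DecidableEq α] {σ : Equiv.Perm α}
    {c : ℕ} (hc : c ∈ fullCycleType σ) : 0 < c := by
  rcases Multiset.mem_add.1 hc with h | h
  · exact (Equiv.Perm.one_lt_of_mem_cycleType h).pos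
  · rw [Multiset.eq_of_mem_replicate h]
    exact one_pos

theorem ZMod.eq_or_eq_of_add_self_eq {n : ℕ} [NeZero n] {a b y : ZMod n} (hab : a ≠ b)
    (hb : a + a = b + b) (hy : a + a = y + y) : y = a ∨ y = b := by
  have hval : ∀ z : ZMod n, a + a = z + z → z = a ∨ 2 * (z - a).val = n := fun z hz => by
    rw [← sub_eq_zero (a := z), ← ZMod.neg_eq_self_iff]
    linear_combination hz
  refine (hval y hy).imp_right fun hya => ?_
  have hba := (hval b hb).resolve_left hab.symm
  exact sub_left_injective (ZMod.val_injective n (by omega) : y - a = b - a)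

namespace Equiv.Perm

variable {α : Type*} {σ ι : Perm α}

theorem apply_zpow_of_semiconjBy_inv (h : SemiconjBy ι σ σ⁻¹) (m : ℤ) (x : α) :
    ι ((σ ^ m) x) = (σ ^ (-m)) (ι x) := by
  have := congrArg (fun p : Perm α => p x) (h.zpow_right m).eq
  simpa using this

/-- If no point satisfies `σ (ι y) = y`, then `ι x = σ ^ m x` forces `m` to be even, and the
midpoint of the path from `x` to `ι x` is fixed by `ι`. -/
theorem exists_fixed_midpoint (h : SemiconjBy ι σ σ⁻¹) (hρ : ∀ y, σ (ι y) ≠ y) {m : ℤ} {x : α}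
    (hx : ι x = (σ ^ m) x) : ∃ j : ℤ, m = j + j ∧ ι ((σ ^ j) x) = (σ ^ j) x := by
  rcases Int.even_or_odd m with ⟨j, rfl⟩ | ⟨j, rfl⟩
  · refine ⟨j, rfl, ?_⟩
    rw [apply_zpow_of_semiconjBy_inv h, hx, ← mul_apply, ← zpow_add]
    congr 2
    ring
  · refine absurd ?_ (hρ ((σ ^ (j + 1)) x))
    rw [apply_zpow_of_semiconjBy_inv h, hx, ← mul_apply, ← mul_apply, ← zpow_one_add, ← zpow_add]
    congr 2
    ring

variable [Fintype α] [DecidableEq α]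

theorem conj_inv_mem_cycleFactorsFinset (h : SemiconjBy ι σ σ⁻¹) {c : Perm α}
    (hc : c ∈ σ.cycleFactorsFinset) : ι * c⁻¹ * ι⁻¹ ∈ σ.cycleFactorsFinset := by
  rw [mem_cycleFactorsFinset_iff] at hc ⊢
  refine ⟨hc.1.inv.conj, fun x hx => ?_⟩
  have hx' : ι⁻¹ x ∈ c⁻¹.support := by
    rw [mem_support] at hx ⊢
    exact fun he => hx (by rw [mul_apply, mul_apply, he, ← mul_apply, mul_inv_cancel, one_apply])
  have hy : c⁻¹ (ι⁻¹ x) ∈ c.support := by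
    rwa [← support_inv, apply_mem_support]
  have h₁ := hc.2 _ hy
  have h₂ : c⁻¹ (ι⁻¹ x) = σ⁻¹ (ι⁻¹ x) := by
    rw [eq_inv_iff_eq, ← h₁, ← mul_apply, mul_inv_cancel, one_apply]
  have h₃ := apply_zpow_of_semiconjBy_inv h (-1) (ι⁻¹ x)
  simp only [zpow_neg, zpow_one, inv_inv, ← mul_apply ι, mul_inv_cancel, one_apply] at h₃
  rw [mul_apply, mul_apply, h₂, ← h₃, mul_apply]

theorem even_card_support_cycleOf (h : SemiconjBy ι σ σ⁻¹) (hρ : ∀ y, σ (ι y) ≠ y) {a : α}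
    (ha : ι a = a) : Even (σ.cycleOf a).support.card := by
  obtain ⟨j, hj, -⟩ := exists_fixed_midpoint h hρ (m := (σ.cycleOf a).support.card) (x := a) (by
    rw [zpow_natCast, ← pow_mod_card_support_cycleOf_self_apply, Nat.mod_self, pow_zero, ha,
      one_apply])
  exact (Int.even_coe_nat _).1 ⟨j, hj⟩

theorem sameCycle_of_fixed_of_fixed (h : SemiconjBy ι σ σ⁻¹) (hρ : ∀ y, σ (ι y) ≠ y) {a b : α}
    (ha : ι a = a) (hfix : ∀ y, ι y = y → y = a ∨ y = b) : σ.SameCycle a b := by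
  have hσa : σ a ≠ a := fun he => hρ a (by rw [ha, he])
  have hcyc := isCycle_cycleOf σ hσa
  obtain ⟨j, hj, hy⟩ := exists_fixed_midpoint h hρ (m := (σ.cycleOf a).support.card) (x := a) (by
    rw [zpow_natCast, ← pow_mod_card_support_cycleOf_self_apply, Nat.mod_self, pow_zero, ha,
      one_apply])
  rcases hfix _ hy with he | he
  · exfalso
    rw [← cycleOf_zpow_apply_self] at he
    have hone : σ.cycleOf a ^ j = 1 := by
      lift j to ℕ using by omega
      rw [zpow_natCast] at he ⊢
      exact hcyc.pow_eq_one_iff.2 ⟨a, by rwa [cycleOf_apply_self], he⟩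
    have hdvd := orderOf_dvd_iff_zpow_eq_one.2 hone
    rw [hcyc.orderOf, hj] at hdvd
    have hpos : 0 < (σ.cycleOf a).support.card := hcyc.two_le_card_support.trans_lt' two_pos
    have := Int.le_of_dvd (by omega) hdvd
    omega
  · exact ⟨j, he⟩

theorem exists_fullCycleType_eq_cons_add_self (h : SemiconjBy ι σ σ⁻¹) (hι : ∀ x, ι (ι x) = x)
    (hρ : ∀ y, σ (ι y) ≠ y) {a b : α} (ha : ι a = a) (hfix : ∀ y, ι y = y → y = a ∨ y = b) :
    ∃ μ : Multiset ℕ, fullCycleType σ = (σ.cycleOf a).support.card ::ₘ (μ + μ) := by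
  have hσa : σ a ≠ a := fun he => hρ a (by rw [ha, he])
  have hab := sameCycle_of_fixed_of_fixed h hρ ha hfix
  have hιι : ι⁻¹ = ι := by
    ext x
    rw [inv_eq_iff_eq, hι]
  have hinv : ∀ x, σ.SameCycle x (ι x) → σ.SameCycle a x := by
    rintro x ⟨m, hm⟩
    obtain ⟨j, -, hy⟩ := exists_fixed_midpoint h hρ hm.symm
    rcases hfix _ hy with he | he
    · exact SameCycle.symm ⟨j, he⟩
    · exact hab.trans (SameCycle.symm ⟨j, he⟩)
  obtain ⟨μ, hμ⟩ := exists_map_eq_add_self_of_involution (fun c : Perm α => ι * c⁻¹ * ι⁻¹)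
    (Finset.card ∘ support) (σ.cycleFactorsFinset.erase (σ.cycleOf a))
    (fun c hc => by
      rw [Finset.mem_erase] at hc ⊢
      refine ⟨fun he => hc.1 ?_, conj_inv_mem_cycleFactorsFinset h hc.2⟩
      refine cycle_is_cycleOf ?_ hc.2
      have : a ∈ (ι * c⁻¹ * ι⁻¹).support := by
        rw [he, mem_support_cycleOf_iff' hσa]
      rw [← support_inv, mem_support]
      rw [mem_support, mul_apply, mul_apply, hιι, ha] at this
      exact fun h' => this (by rw [h', ha]))
    (fun c hc he => by
      rw [Finset.mem_erase] at hc
      obtain ⟨x, hx⟩ := (mem_cycleFactorsFinset_iff.1 hc.2).1.nonempty_support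
      have hcx := cycle_is_cycleOf hx hc.2
      have hιx : ι x ∈ c.support := by
        rw [← he, support_conj, support_inv]
        exact Finset.mem_map_of_mem _ hx
      rw [hcx, mem_support_cycleOf_iff] at hιx
      exact hc.1 (by rw [hcx, (hinv x hιx.1).cycleOf_eq]))
    (fun c _ => by
      have : ι * ι = 1 := by
        ext x
        exact hι x
      simp only [hιι, mul_inv_rev, inv_inv]
      rw [← mul_assoc, ← mul_assoc, this, one_mul, mul_assoc, this, mul_one])
    (fun c _ => by simp only [Function.comp_apply, card_support_conj, support_inv])
  obtain ⟨ν, hν⟩ := exists_map_eq_add_self_of_involution ι (fun _ => 1)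
    (Finset.univ.filter fun x => σ x = x)
    (fun x hx => by
      rw [Finset.mem_filter_univ] at hx ⊢
      have := apply_zpow_of_semiconjBy_inv h (-1) x
      rw [zpow_neg_one, neg_neg, zpow_one, inv_eq_iff_eq.2 hx.symm] at this
      exact this.symm)
    (fun x hx he => by
      rw [Finset.mem_filter_univ] at hx
      exact hρ x (by rw [he, hx]))
    (fun x _ => hι x) (fun _ _ => rfl)
  refine ⟨μ + ν, ?_⟩
  have hmem : σ.cycleOf a ∈ σ.cycleFactorsFinset :=
    cycleOf_mem_cycleFactorsFinset_iff.2 (mem_support.2 hσa)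
  rw [Multiset.map_const', Finset.card_val] at hν
  rw [fullCycleType, hν, cycleType_def, ← Finset.insert_erase hmem,
    Finset.insert_val_of_notMem (Finset.notMem_erase _ _), Multiset.map_cons, hμ,
    Multiset.cons_add, add_add_add_comm]
  rfl

end Equiv.Perm

/-- for `n` even and `t.val` even, the two self-inverses `a, b` lie in the
same cycle of the RI proliferating permutation, their cycle has even length `k`, and the
full cycle type is `k ::ₘ (μ + μ)` for some multiset `μ` of positive naturals with
`k + 2 * μ.sum = n`. -/
theorem stmt_7 (n : ℕ) [NeZero n] (hn : Even n) (t : ZMod n) (ht : Even t.val)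
    (s : Fin n ≃ ZMod n) (hs : s 0 = 0)
    (σ : Equiv.Perm (ZMod n)) (hσ : ∀ x : ZMod n, σ x = t - s (Fin.rev (s.symm x)))
    (a b : ZMod n) (ha : a + a = t) (hb : b + b = t) (hab : a ≠ b) :
    σ.SameCycle a b ∧
      ∃ k : ℕ, Even k ∧ Set.ncard {y : ZMod n | ∃ m : ℤ, (σ ^ m) a = y} = k ∧
        ∃ μ : Multiset ℕ, (∀ c ∈ μ, 0 < c) ∧ k + 2 * μ.sum = n ∧
          fullCycleType σ = k ::ₘ (μ + μ) := by
  have hrev : ∀ i : Fin n, i.rev ≠ i := fun i he => by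
    have := congrArg Fin.val he
    rw [Fin.val_rev] at this
    obtain ⟨m, hm⟩ := hn
    have := i.isLt
    omega
  let ι : Equiv.Perm (ZMod n) := Equiv.subLeft t
  have hι_apply : ∀ x, ι x = t - x := fun x => rfl
  have hι : ∀ x, ι (ι x) = x := fun x => sub_sub_cancel t x
  have hισ : ∀ x, ι (σ x) = s (Fin.rev (s.symm x)) := fun x => by
    rw [hι_apply, hσ, sub_sub_cancel]
  have hρρ : ∀ x, ι (σ (ι (σ x))) = x := fun x => by
    rw [hισ, hισ, Equiv.symm_apply_apply, Fin.rev_rev, Equiv.apply_symm_apply]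
  have hsemi : SemiconjBy ι σ σ⁻¹ := by
    ext1 x
    rw [Equiv.Perm.mul_apply, Equiv.Perm.mul_apply, Equiv.Perm.eq_inv_iff_eq, ← hι (σ _), hρρ]
  have hρ : ∀ y, σ (ι y) ≠ y := fun y he => by
    have h₁ := hισ (ι y)
    rw [he] at h₁
    have h₂ := congrArg s.symm h₁
    rw [Equiv.symm_apply_apply] at h₂
    exact hrev _ h₂.symm
  have hfix : ∀ y, ι y = y → y = a ∨ y = b := fun y hy => by
    have hy' : y + y = t := by
      nth_rewrite 1 [← hy]
      rw [hι_apply, sub_add_cancel]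
    exact ZMod.eq_or_eq_of_add_self_eq hab (ha.trans hb.symm) (ha.trans hy'.symm)
  have hιa : ι a = a := by rw [hι_apply, ← ha, add_sub_cancel_right]
  have hσa : σ a ≠ a := fun he => hρ a (by rw [hιa, he])
  obtain ⟨μ, hμ⟩ := Equiv.Perm.exists_fullCycleType_eq_cons_add_self hsemi hι hρ hιa hfix
  refine ⟨Equiv.Perm.sameCycle_of_fixed_of_fixed hsemi hρ hιa hfix, _,
    Equiv.Perm.even_card_support_cycleOf hsemi hρ hιa, ?_, μ, fun c hc => ?_, ?_, hμ⟩
  · rw [← Set.ncard_coe_finset]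
    congr 1
    ext y
    exact (Equiv.Perm.mem_support_cycleOf_iff' hσa).symm
  · exact pos_of_mem_fullCycleType (σ := σ)
      (hμ ▸ Multiset.mem_cons_of_mem (Multiset.mem_add.2 (Or.inl hc)))
  · have hsum := sum_fullCycleType σ
    rw [hμ, Multiset.sum_cons, Multiset.sum_add, ZMod.card] at hsum
    rw [two_mul, hsum]
end

section
/- Let n be an odd natural number with n ≥ 3 and let t : ZMod n with t ≠ 0. Then for every odd natural number k with 1 ≤ k ≤ n and every multiset μ of positive natural numbers with k + 2 · μ.sum = n, there exists a series s : Fin n ≃ ZMod n with s 0 = 0 such that the full cycle type of the proliferating permutation of s under retrograde inversion with transposition t equals k ::ₘ (μ + μ). -/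
open Equiv Equiv.Perm in
theorem Equiv.Perm.cycleType_permCongr_s11 {α β : Type*} [Fintype α] [DecidableEq α] [Fintype β]
    [DecidableEq β] (e : α ≃ β) (σ : Perm α) : (e.permCongr σ).cycleType = σ.cycleType := by
  let f : α ≃ {_b : β // True} := e.trans (Equiv.Set.univ β).symm
  have h : e.permCongr σ = σ.extendDomain f := by
    ext y
    obtain ⟨x, rfl⟩ := e.surjective y
    rw [permCongr_apply, symm_apply_apply]
    exact (Perm.extendDomain_apply_image σ f x).symm
  rw [h, cycleType_extendDomain]

open Equiv Equiv.Perm in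
theorem Equiv.Perm.cycleType_sumCongr_s11 {α β : Type*} [Fintype α] [DecidableEq α] [Fintype β]
    [DecidableEq β] (σ : Perm α) (τ : Perm β) :
    (sumCongr σ τ).cycleType = σ.cycleType + τ.cycleType := by
  have hσ : (sumCongr σ (1 : Perm β)).cycleType = σ.cycleType := by
    have h : sumCongr σ (1 : Perm β) =
        σ.extendDomain (Equiv.ofInjective (Sum.inl : α → α ⊕ β) Sum.inl_injective) := by
      ext x
      rcases x with x | x
      · exact (Perm.extendDomain_apply_image σ
          (Equiv.ofInjective (Sum.inl : α → α ⊕ β) Sum.inl_injective) x).symm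
      · rw [Perm.extendDomain_apply_not_subtype _ _ (by simp)]
        rfl
    rw [h, cycleType_extendDomain]
  have hτ : (sumCongr (1 : Perm α) τ).cycleType = τ.cycleType := by
    have h : sumCongr (1 : Perm α) τ =
        τ.extendDomain (Equiv.ofInjective (Sum.inr : β → α ⊕ β) Sum.inr_injective) := by
      ext x
      rcases x with x | x
      · rw [Perm.extendDomain_apply_not_subtype _ _ (by simp)]
        rfl
      · exact (Perm.extendDomain_apply_image τ
          (Equiv.ofInjective (Sum.inr : β → α ⊕ β) Sum.inr_injective) x).symm
    rw [h, cycleType_extendDomain]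
  have hd : Disjoint (sumCongr σ (1 : Perm β)) (sumCongr (1 : Perm α) τ) := by
    rintro (x | x) <;> simp
  rw [← hσ, ← hτ, ← hd.cycleType_mul, sumCongr_mul, mul_one, one_mul]

/-- An involution with exactly one fixed point. -/
def IsReflection {α : Type*} (f : Equiv.Perm α) : Prop :=
  Function.Involutive f ∧ ∃! x, f x = x

theorem IsReflection.permCongr {α β : Type*} {f : Equiv.Perm α} (hf : IsReflection f)
    (e : α ≃ β) : IsReflection (e.permCongr f) := by
  obtain ⟨hi, x, hx, hu⟩ := hf
  refine ⟨fun y => by simp [hi (e.symm y)], e x, by simp [hx], fun y hy => ?_⟩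
  rw [← e.symm_apply_eq.mp (hu (e.symm y) _)]
  simpa [Equiv.eq_symm_apply] using hy

theorem IsReflection.card_support {α : Type*} [Fintype α] [DecidableEq α] {f : Equiv.Perm α}
    (hf : IsReflection f) : f.support.card = Fintype.card α - 1 := by
  obtain ⟨-, x, hx, hu⟩ := hf
  have : f.support = {x}ᶜ := by
    ext y
    simp only [Equiv.Perm.mem_support, Finset.mem_compl, Finset.mem_singleton, not_iff_not]
    exact ⟨hu y, fun h => h ▸ hx⟩
  rw [this, Finset.card_compl, Finset.card_singleton]

theorem IsReflection.exists_permCongr_eq {α β : Type*} [Fintype α] [Fintype β]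
    (h : Fintype.card α = Fintype.card β) {f : Equiv.Perm α} {g : Equiv.Perm β}
    (hf : IsReflection f) (hg : IsReflection g) : ∃ e : α ≃ β, e.permCongr f = g := by
  classical
  let e := Fintype.equivOfCardEq h
  have hf' := hf.permCongr e
  have hsq : ∀ {u : Equiv.Perm β}, IsReflection u → u ^ 2 = 1 := fun hu =>
    Equiv.ext fun x => by simpa [sq] using hu.1 x
  have h1 := Equiv.Perm.cycleType_of_pow_prime_eq_one (hsq hf')
  have h2 := Equiv.Perm.cycleType_of_pow_prime_eq_one (hsq hg)
  have hs : (e.permCongr f).cycleType.sum = g.cycleType.sum := by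
    rw [Equiv.Perm.sum_cycleType, Equiv.Perm.sum_cycleType, hf'.card_support, hg.card_support]
  rw [h1, h2, Multiset.sum_replicate, Multiset.sum_replicate, smul_eq_mul, smul_eq_mul] at hs
  have hc := Equiv.Perm.isConj_of_cycleType_eq
    (h1.trans ((by rw [Nat.eq_of_mul_eq_mul_right two_pos hs]) : _ = _) |>.trans h2.symm)
  obtain ⟨c, hc⟩ := isConj_iff.mp hc
  refine ⟨e.trans c, ?_⟩
  rw [← hc]
  ext x
  simp [Equiv.Perm.inv_def]

theorem Function.Involutive.exists_perm_commuting {α : Type*} {f : Equiv.Perm α}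
    (hf : Function.Involutive f) {x y : α} (hx : f x ≠ x) (hy : f y ≠ y) :
    ∃ d : Equiv.Perm α, d x = y ∧ ∀ z, d (f z) = f (d z) := by
  classical
  by_cases h1 : y = x
  · exact ⟨1, h1.symm, fun _ => rfl⟩
  by_cases h2 : y = f x
  · exact ⟨f, h2.symm, fun _ => rfl⟩
  have h3 : f y ≠ x := fun h => h2 (by rw [← h, hf y])
  have h4 : f x ≠ f y := fun h => h1 (f.injective h).symm
  refine ⟨Equiv.swap x y * Equiv.swap (f x) (f y), ?_, fun z => ?_⟩
  · rw [Equiv.Perm.mul_apply, Equiv.swap_apply_of_ne_of_ne hx.symm h3.symm, Equiv.swap_apply_left]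
  · have hfx := hf x
    have hfy := hf y
    have hfz := hf z
    simp only [Equiv.Perm.mul_apply, Equiv.swap_apply_def]
    grind

theorem isReflection_subLeft {n : ℕ} (hn : Odd n) (c : ZMod n) :
    IsReflection (Equiv.subLeft c) := by
  refine ⟨fun x => by simp, ?_⟩
  obtain ⟨m, rfl⟩ := hn
  have h0 : (2 * m + 1 : ZMod (2 * m + 1)) = 0 := by
    exact_mod_cast ZMod.natCast_self (2 * m + 1)
  refine ⟨(m + 1) * c, ?_, fun y hy => ?_⟩
  · simp only [Equiv.subLeft_apply]
    linear_combination (-c) * h0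
  · simp only [Equiv.subLeft_apply] at hy
    linear_combination (-y) * h0 - (m + 1) * hy

theorem isReflection_revPerm {n : ℕ} (hn : Odd n) :
    IsReflection (Fin.revPerm : Equiv.Perm (Fin n)) := by
  obtain ⟨m, rfl⟩ := hn
  refine ⟨Fin.rev_rev, ⟨m, by omega⟩, ?_, fun y hy => ?_⟩
  · simp [Fin.ext_iff, Fin.val_rev]
    omega
  · simp [Fin.ext_iff, Fin.val_rev] at hy ⊢
    omega

theorem ZMod.cycleType_addRight_one {k : ℕ} [NeZero k] :
    (Equiv.addRight (1 : ZMod k)).cycleType = ({k} : Multiset ℕ).filter (2 ≤ ·) := by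
  obtain _ | _ | m := k
  · exact absurd rfl (NeZero.ne 0)
  · have : Equiv.addRight (1 : ZMod (0 + 1)) = 1 :=
      Equiv.ext fun x => Subsingleton.elim (α := Fin 1) _ _
    rw [this, Equiv.Perm.cycleType_one, Multiset.filter_singleton]
    rfl
  · have : Equiv.addRight (1 : ZMod (m + 1 + 1)) = finRotate (m + 2) :=
      Equiv.ext fun x => (finRotate_apply (n := m + 2) x).symm
    rw [this]
    rw [Multiset.filter_singleton, if_pos (by omega)]
    exact cycleType_finRotate

theorem fullCycleType_eq_of_cycleType_eq {α : Type*} [Fintype α] [DecidableEq α]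
    {σ : Equiv.Perm α} {m : Multiset ℕ} (hσ : σ.cycleType = m.filter (2 ≤ ·))
    (hpos : ∀ c ∈ m, 0 < c) (hsum : m.sum = Fintype.card α) : fullCycleType σ = m := by
  have hrep : m.filter (fun c => ¬ 2 ≤ c) =
      Multiset.replicate (m.filter (fun c => ¬ 2 ≤ c)).card 1 := by
    refine Multiset.eq_replicate.mpr ⟨rfl, fun c hc => ?_⟩
    rw [Multiset.mem_filter] at hc
    have := hpos c hc.1
    omega
  have hsplit := Multiset.filter_add_not (2 ≤ ·) m
  have hfix : (Finset.univ.filter fun x => σ x = x).card =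
      (m.filter (fun c => ¬ 2 ≤ c)).card := by
    have h1 := congrArg Multiset.sum hsplit
    rw [Multiset.sum_add, hrep, Multiset.sum_replicate, ← hσ, Equiv.Perm.sum_cycleType, hsum,
      smul_eq_mul, mul_one] at h1
    have h2 := Finset.card_filter_add_card_filter_not (s := Finset.univ) (fun x => σ x = x)
    rw [Finset.card_univ] at h2
    change _ + σ.support.card = _ at h2
    omega
  rw [fullCycleType, hfix, ← hrep, hσ, hsplit]

/-- The type `k ::ₘ (μ + μ)` is the type of a product of two reflections: on the `ZMod k` summand
take `x ↦ 1 - x` after `x ↦ -x`; on the other two summands, a permutation `π` of type `μ` on the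
left and `π⁻¹` on the right form a product of two fixed-point-free involutions. -/
theorem exists_isReflection_mul_cycleType {k : ℕ} [NeZero k] (hk : Odd k) {μ : Multiset ℕ} :
    ∃ a b : Equiv.Perm (ZMod k ⊕ (Fin μ.sum ⊕ Fin μ.sum)), IsReflection a ∧ IsReflection b ∧
      (a * b).cycleType = (k ::ₘ (μ + μ)).filter (2 ≤ ·) := by
  obtain ⟨π, hπ⟩ := (Equiv.Perm.exists_with_cycleType_iff (α := Fin μ.sum)
    (m := μ.filter (2 ≤ ·))).mpr ⟨by
      rw [Fintype.card_fin]
      conv_rhs => rw [← Multiset.filter_add_not (2 ≤ ·) μ, Multiset.sum_add]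
      exact Nat.le_add_right _ _, fun c hc => (Multiset.mem_filter.mp hc).2⟩
  have extend : ∀ (c : ZMod k) (g : Equiv.Perm (Fin μ.sum ⊕ Fin μ.sum)),
      Function.Involutive g → (∀ y, g y ≠ y) →
      IsReflection (Equiv.Perm.sumCongr (Equiv.subLeft c) g) := by
    intro c g hg hfix
    obtain ⟨hi, x, hx, hu⟩ := isReflection_subLeft hk c
    refine ⟨?_, Sum.inl x, by simpa using hx, ?_⟩
    · rintro (y | y)
      · simp
      · simp [hg y]
    · rintro (y | y) hy
      · exact congrArg Sum.inl (hu y (Sum.inl_injective hy))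
      · exact absurd (Sum.inr_injective hy) (hfix y)
  let g : Equiv.Perm (Fin μ.sum ⊕ Fin μ.sum) := Equiv.sumComm _ _
  refine ⟨Equiv.Perm.sumCongr (Equiv.subLeft 1) (Equiv.Perm.sumCongr π π⁻¹ * g),
    Equiv.Perm.sumCongr (Equiv.subLeft 0) g, extend _ _ ?_ ?_, extend _ _ ?_ ?_, ?_⟩
  · rintro (y | y) <;> simp [g]
  · rintro (y | y) <;> simp [g]
  · rintro (y | y) <;> simp [g]
  · rintro (y | y) <;> simp [g]
  · have hg : g * g = 1 := by ext (y | y) <;> simp [g]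
    have hadd : Equiv.subLeft (1 : ZMod k) * Equiv.subLeft 0 = Equiv.addRight (1 : ZMod k) := by
      ext x
      simp [add_comm]
    rw [Equiv.Perm.sumCongr_mul, mul_assoc, hg, mul_one, hadd, Equiv.Perm.cycleType_sumCongr_s11,
      Equiv.Perm.cycleType_sumCongr_s11, Equiv.Perm.cycleType_inv, hπ, ZMod.cycleType_addRight_one,
      ← Multiset.singleton_add, Multiset.filter_add, Multiset.filter_add]

/-- Every reflection of `ZMod n` that moves `0` is position reversal for some series starting
at `0`. -/
theorem IsReflection.exists_series {n : ℕ} [NeZero n] (hn : Odd n) (hn3 : 3 ≤ n)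
    {τ : Equiv.Perm (ZMod n)} (hτ : IsReflection τ) (h0 : τ 0 ≠ 0) :
    ∃ s : Fin n ≃ ZMod n, s 0 = 0 ∧ s.permCongr Fin.revPerm = τ := by
  obtain ⟨s, hs⟩ := (isReflection_revPerm hn).exists_permCongr_eq (by simp [ZMod.card]) hτ
  have hmove : τ (s 0) ≠ s 0 := by
    rw [← hs]
    simp [Fin.ext_iff, Fin.val_rev]
    omega
  obtain ⟨d, hd, hcomm⟩ := hτ.1.exists_perm_commuting hmove h0
  refine ⟨s.trans d, hd, Equiv.ext fun x => ?_⟩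
  have h := hcomm (d.symm x)
  rw [Equiv.apply_symm_apply] at h
  rw [← h, ← hs]
  simp

/-- for `n` odd, `n ≥ 3` and `t ≠ 0`, every structure `k ::ₘ (μ + μ)` with
`k` odd, `1 ≤ k ≤ n`, `μ` a multiset of positive naturals and `k + 2 * μ.sum = n`, is
realized as the full cycle type of the RI proliferating permutation of some series. -/
theorem stmt_11 (n : ℕ) [NeZero n] (hn : Odd n) (hn3 : 3 ≤ n) (t : ZMod n) (ht : t ≠ 0)
    (k : ℕ) (hk : Odd k) (hk1 : 1 ≤ k) (hkn : k ≤ n)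
    (μ : Multiset ℕ) (hμ : ∀ c ∈ μ, 0 < c) (hsum : k + 2 * μ.sum = n) :
    ∃ s : Fin n ≃ ZMod n, s 0 = 0 ∧ fullCycleType (ppRI t s) = k ::ₘ (μ + μ) := by
  have : NeZero k := ⟨by omega⟩
  obtain ⟨a, b, ha, hb, hab⟩ := exists_isReflection_mul_cycleType hk (μ := μ)
  have hcard : Fintype.card (ZMod k ⊕ (Fin μ.sum ⊕ Fin μ.sum)) = Fintype.card (ZMod n) := by
    simp only [Fintype.card_sum, ZMod.card, Fintype.card_fin]
    omega
  have hι := isReflection_subLeft hn t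
  obtain ⟨e, he, hne⟩ : ∃ e : ZMod k ⊕ (Fin μ.sum ⊕ Fin μ.sum) ≃ ZMod n,
      e.permCongr a = Equiv.subLeft t ∧ e.permCongr b 0 ≠ 0 := by
    obtain ⟨e, he⟩ := ha.exists_permCongr_eq hcard hι
    by_cases h : e.permCongr b 0 = 0
    · refine ⟨e.trans (Equiv.subLeft t), ?_, fun h' => ht ?_⟩
      · calc (e.trans (Equiv.subLeft t)).permCongr a
            = (Equiv.subLeft t).permCongr (e.permCongr a) := rfl
          _ = Equiv.subLeft t := by
            rw [he]
            ext x
            simp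
      · obtain ⟨-, x, -, hu⟩ := hb.permCongr e
        have h'' : e.permCongr b t = t := by
          have h3 : t - e.permCongr b t = 0 := by simpa using h'
          exact (sub_eq_zero.mp h3).symm
        exact (hu t h'').trans (hu 0 h).symm
    · exact ⟨e, he, h⟩
  obtain ⟨s, hs0, hs⟩ := (hb.permCongr e).exists_series hn hn3 hne
  refine ⟨s, hs0, fullCycleType_eq_of_cycleType_eq ?_ ?_ ?_⟩
  · have hpp : ppRI t s = e.permCongr (a * b) := by
      calc ppRI t s = Equiv.subLeft t * s.permCongr Fin.revPerm := rfl
        _ = e.permCongr a * e.permCongr b := by rw [hs, he]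
        _ = e.permCongr (a * b) := by
          ext x
          simp
    rw [hpp, Equiv.Perm.cycleType_permCongr_s11, hab]
  · simp only [Multiset.mem_cons, Multiset.mem_add, or_self]
    rintro c (rfl | hc)
    · exact hk1
    · exact hμ c hc
  · rw [Multiset.sum_cons, Multiset.sum_add, ZMod.card]
    omega
end

section
/- Let n be a positive even natural number and let t : ZMod n be the element (n/2 : ZMod n). Let s : Fin n ≃ ZMod n be a series with s 0 = 0 and let σ be the proliferating permutation of s under retrogradation with transposition t. Let ι be the involution of ZMod n given by ι x = x + n/2. Then ι ∘ σ ∘ ι = σ⁻¹, and for every x : ZMod n the points x and x + n/2 do not lie in the same cycle of σ, i.e. ¬ σ.SameCycle x (x + n/2). -/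
theorem mul_zpow_mul_eq_of_mul_self {G : Type*} [Group G] {a b : G}
    (ha : a * a = 1) (hb : b * b = 1) (m : ℤ) : a * (a * b) ^ m = (a * b) ^ (-m) * a := by
  have ha' : a⁻¹ = a := inv_eq_of_mul_eq_one_right ha
  have hb' : b⁻¹ = b := inv_eq_of_mul_eq_one_right hb
  have h : SemiconjBy a (a * b) (a * b)⁻¹ := by
    simp only [SemiconjBy, mul_inv_rev, ha', hb', mul_assoc, ha, mul_one]
    rw [← mul_assoc, ha, one_mul]
  simpa only [SemiconjBy, inv_zpow, zpow_neg] using h.zpow_right m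

/-- For two fixed-point-free involutions `a` and `b`, the points `x` and `a x` lie in different
cycles of `a * b`. -/
theorem Equiv.Perm.not_sameCycle_mul_of_involutions {α : Type*} {a b : Equiv.Perm α}
    (ha : a * a = 1) (hb : b * b = 1) (ha' : ∀ x, a x ≠ x) (hb' : ∀ x, b x ≠ x) (x : α) :
    ¬ (a * b).SameCycle x (a x) := by
  rintro ⟨k, hk⟩
  have key (m : ℤ) : a (((a * b) ^ m) x) = ((a * b) ^ (-m)) (a x) :=
    DFunLike.congr_fun (mul_zpow_mul_eq_of_mul_self ha hb m) x
  obtain ⟨m, rfl | rfl⟩ := Int.even_or_odd' k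
  · apply ha' (((a * b) ^ m) x)
    rw [key, ← hk, ← Equiv.Perm.mul_apply, ← zpow_add]
    congr 2
    ring
  · apply hb' (((a * b) ^ m) x)
    apply a.injective
    rw [key, ← hk, ← Equiv.Perm.mul_apply, ← Equiv.Perm.mul_apply, ← Equiv.Perm.mul_apply,
      ← zpow_add, ← zpow_one_add]
    congr 2
    ring


/-- for `n` even and `t = n/2`, conjugating the R proliferating permutation
by the involution `ι x = x + n/2` gives its inverse, and `x` and `x + n/2` never lie in
the same cycle. -/
theorem stmt_13 (n : ℕ) [NeZero n] (hn : Even n)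
    (s : Fin n ≃ ZMod n) (hs : s 0 = 0)
    (σ : Equiv.Perm (ZMod n))
    (hσ : ∀ x : ZMod n, σ x = s (Fin.rev (s.symm x)) + ((n / 2 : ℕ) : ZMod n))
    (ι : Equiv.Perm (ZMod n)) (hι : ∀ x : ZMod n, ι x = x + ((n / 2 : ℕ) : ZMod n)) :
    ι * σ * ι = σ⁻¹ ∧
      ∀ x : ZMod n, ¬ σ.SameCycle x (x + ((n / 2 : ℕ) : ZMod n)) := by
  have hn0 : n ≠ 0 := NeZero.ne n
  obtain ⟨m, hm⟩ := hn
  have half_add : ((n / 2 : ℕ) : ZMod n) + ((n / 2 : ℕ) : ZMod n) = 0 := by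
    rw [← Nat.cast_add, show n / 2 + n / 2 = n by omega, ZMod.natCast_self]
  have half_ne : ((n / 2 : ℕ) : ZMod n) ≠ 0 := by
    rw [Ne, ZMod.natCast_eq_zero_iff]
    intro h
    have := Nat.le_of_dvd (by omega) h
    omega
  let ρ : Equiv.Perm (ZMod n) := (s.symm.trans Fin.revPerm).trans s
  have ρ_apply (x : ZMod n) : ρ x = s (Fin.rev (s.symm x)) := rfl
  have ι_sq : ι * ι = 1 := by
    ext1 x
    simp [hι, add_assoc, half_add]
  have ρ_sq : ρ * ρ = 1 := by
    ext1 x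
    simp [ρ_apply]
  have ι_ne (x : ZMod n) : ι x ≠ x := by simpa [hι] using half_ne
  have ρ_ne (x : ZMod n) : ρ x ≠ x := by
    rw [ρ_apply, Ne, ← Equiv.eq_symm_apply, Fin.ext_iff, Fin.val_rev]
    omega
  have σ_eq : σ = ι * ρ := by
    ext1 x
    rw [hσ, Equiv.Perm.mul_apply, hι, ρ_apply]
  subst σ_eq
  refine ⟨?_, fun x => ?_⟩
  · have h := mul_zpow_mul_eq_of_mul_self ι_sq ρ_sq 1
    rw [zpow_one, zpow_neg_one] at h
    rw [h, mul_assoc, ι_sq, mul_one]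
  · rw [← hι]
    exact Equiv.Perm.not_sameCycle_mul_of_involutions ι_sq ρ_sq ι_ne ρ_ne x
end

section
/- Let n be a positive natural number and t : ZMod n with Nat.gcd n t.val = 1. Let s : Fin n ≃ ZMod n be a series with s 0 = 0 and let σ be the proliferating permutation of s under retrogradation with transposition t. Then the number of cycles of σ (i.e. the cardinality of the full cycle type of σ, counting fixed points) is at most n/2 + 1 (with natural-number division). -/
/-- The full cycle type has at most as many parts as there are orbits. -/
theorem card_fullCycleType_le_card_quotient {α : Type*} [Fintype α] [DecidableEq α]
    (σ : Equiv.Perm α) :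
    Multiset.card (fullCycleType σ) ≤ Nat.card (Quotient (Equiv.Perm.SameCycle.setoid σ)) := by
  classical
  have hc (c : σ.cycleFactorsFinset) : ∃ x, x ∈ c.1.support :=
    (Equiv.Perm.mem_cycleFactorsFinset_iff.1 c.2).1.nonempty_support
  choose p hp using hc
  have hcyc (c : σ.cycleFactorsFinset) : c.1 = σ.cycleOf (p c) :=
    Equiv.Perm.cycle_is_cycleOf (hp c) c.2
  have hmove (c : σ.cycleFactorsFinset) : σ (p c) ≠ p c :=
    Equiv.Perm.mem_support.1 (Equiv.Perm.mem_cycleFactorsFinset_support_le c.2 (hp c))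
  let f : σ.cycleFactorsFinset ⊕ {x // σ x = x} → Quotient (Equiv.Perm.SameCycle.setoid σ) :=
    Sum.elim (fun c => Quotient.mk _ (p c)) (fun x => Quotient.mk _ x.1)
  have hf : Function.Injective f := by
    rintro (c | x) (d | y) h
    · have h' : σ.SameCycle (p c) (p d) := Quotient.exact h
      exact congrArg _ (Subtype.ext (by rw [hcyc c, hcyc d, h'.cycleOf_eq]))
    · have h' : σ.SameCycle (p c) y.1 := Quotient.exact h
      exact absurd (h'.apply_eq_self_iff.2 y.2) (hmove c)
    · have h' : σ.SameCycle x.1 (p d) := Quotient.exact h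
      exact absurd (h'.apply_eq_self_iff.1 x.2) (hmove d)
    · have h' : σ.SameCycle x.1 y.1 := Quotient.exact h
      exact congrArg _ (Subtype.ext (h'.eq_of_left x.2))
  have h := Nat.card_le_card_of_injective f hf
  rw [Nat.card_sum, Nat.card_eq_fintype_card, Nat.card_eq_fintype_card, Fintype.card_coe,
    Fintype.card_subtype] at h
  simpa [fullCycleType, Equiv.Perm.cycleType_def] using h

/-- for `gcd n t.val = 1`, the R proliferating permutation has at most
`n/2 + 1` cycles (counting fixed points). -/
theorem stmt_15 (n : ℕ) [NeZero n] (t : ZMod n) (ht : Nat.gcd n t.val = 1)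
    (s : Fin n ≃ ZMod n) (hs : s 0 = 0)
    (σ : Equiv.Perm (ZMod n)) (hσ : ∀ x : ZMod n, σ x = s (Fin.rev (s.symm x)) + t) :
    Multiset.card (fullCycleType σ) ≤ n / 2 + 1 := by
  classical
  refine (card_fullCycleType_le_card_quotient σ).trans ?_
  let q : ZMod n → Quotient (Equiv.Perm.SameCycle.setoid σ) := Quotient.mk _
  let e : Fin n → Sym2 (Quotient (Equiv.Perm.SameCycle.setoid σ)) :=
    fun i => s(q (s i), q (s i.rev))
  let E := (Finset.univ.filter fun i : Fin n => i.val < n / 2).image e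
  let G := SimpleGraph.fromEdgeSet (E : Set (Sym2 (Quotient (Equiv.Perm.SameCycle.setoid σ))))
  have hadj (i : Fin n) (hi : i.val < n / 2) : G.Reachable (q (s i)) (q (s i.rev)) := by
    by_cases h : q (s i) = q (s i.rev)
    · rw [h]
    · refine SimpleGraph.Adj.reachable ((SimpleGraph.fromEdgeSet_adj _).2 ⟨?_, h⟩)
      exact Finset.mem_coe.2 (Finset.mem_image_of_mem e (by simpa using hi))
  have hrev (i : Fin n) : G.Reachable (q (s i)) (q (s i.rev)) := by
    rcases lt_or_ge i.val (n / 2) with hi | hi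
    · exact hadj i hi
    · rcases lt_or_ge i.rev.val (n / 2) with hj | hj
      · simpa using (hadj i.rev hj).symm
      · have : i.rev = i := by
          ext
          rw [Fin.val_rev] at hj ⊢
          omega
        rw [this]
  have hstep (x : ZMod n) : G.Reachable (q x) (q (x + t)) := by
    have h : q (x + t) = q (s (s.symm x).rev) := by
      refine Quotient.sound (Equiv.Perm.SameCycle.symm ⟨1, ?_⟩)
      simp [hσ]
    rw [h]
    simpa using hrev (s.symm x)
  have hmul (k : ℕ) : G.Reachable (q 0) (q (k * t)) := by
    induction k with
    | zero => simp
    | succ k ih => simpa [add_mul] using ih.trans (hstep _)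
  have hunit : IsUnit t := by
    rw [← ZMod.natCast_zmod_val t, ZMod.isUnit_iff_coprime]
    exact Nat.Coprime.symm ht
  have hall (x : ZMod n) : G.Reachable (q 0) (q x) := by
    have h := hmul (x * t⁻¹).val
    rwa [ZMod.natCast_zmod_val, mul_assoc, ZMod.inv_mul_of_unit t hunit, mul_one] at h
  have hconn : G.Connected := by
    refine SimpleGraph.connected_iff_exists_forall_reachable _ |>.2 ⟨q 0, ?_⟩
    rintro ⟨x⟩
    exact hall x
  refine hconn.card_vert_le_card_edgeSet_add_one.trans (Nat.add_le_add_right ?_ 1)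
  calc Nat.card G.edgeSet ≤ E.card := by
        rw [Nat.card_coe_set_eq, ← Set.ncard_coe_finset]
        refine Set.ncard_le_ncard ?_ E.finite_toSet
        rw [SimpleGraph.edgeSet_fromEdgeSet]
        exact Set.sdiff_subset
    _ ≤ (Finset.univ.filter fun i : Fin n => i.val < n / 2).card := Finset.card_image_le
    _ ≤ (Finset.range (n / 2)).card :=
        Finset.card_le_card_of_injOn Fin.val (fun i hi => by simpa using hi)
          Fin.val_injective.injOn
    _ = n / 2 := Finset.card_range _
end

section
/- Let n be a positive natural number and t : ZMod n with Nat.gcd n t.val = 1. Let s : Fin n ≃ ZMod n be a series with s 0 = 0 and let σ be the proliferating permutation of s under retrogradation with transposition t. Let k be the number of even elements of the full cycle type of σ (counted with multiplicity), i.e. the number of cycles of σ of even length. Then k is even if and only if n % 4 = 1 or n % 4 = 2 (equivalently, k is odd if and only if n % 4 = 0 or n % 4 = 3). -/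
open Equiv in
/-- The sign of a permutation is determined by the parity of its number of even-length cycles. -/
theorem sign_eq_neg_one_pow_card_filter_even {α : Type*} [Fintype α] [DecidableEq α]
    (σ : Perm α) :
    Perm.sign σ = (-1) ^ Multiset.card ((fullCycleType σ).filter fun c => Even c) := by
  have h (m : Multiset ℕ) : (m.map fun c => -(-1 : ℤˣ) ^ c).prod =
      (-1) ^ Multiset.card (m.filter fun c => Even c) := by
    induction m using Multiset.induction_on with
    | empty => simp
    | cons a m ih =>
      rcases Nat.even_or_odd a with ha | ha
      · rw [Multiset.map_cons, Multiset.prod_cons, ih, Multiset.filter_cons_of_pos _ ha,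
          Multiset.card_cons, ha.neg_one_pow, pow_succ']
      · rw [Multiset.map_cons, Multiset.prod_cons, ih,
          Multiset.filter_cons_of_neg _ (Nat.not_even_iff_odd.mpr ha), ha.neg_one_pow,
          neg_neg, one_mul]
  have h1 (j : ℕ) : (Multiset.replicate j 1).filter (fun c => Even c) = 0 := by
    rw [Multiset.filter_eq_nil]
    intro a ha
    simp [Multiset.eq_of_mem_replicate ha]
  rw [fullCycleType, Multiset.filter_add, h1, add_zero, ← h, Perm.sign_of_cycleType']

open Equiv in
theorem sign_finRevPerm (n : ℕ) : Perm.sign (Fin.revPerm : Perm (Fin n)) = (-1) ^ (n / 2) := by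
  rw [Perm.sign_of_pow_two_eq_one (by ext x; simp [pow_two])]
  have hfix : Fintype.card (Function.fixedPoints (Fin.revPerm : Perm (Fin n))) ≤ 1 := by
    rw [Fintype.card_le_one_iff_subsingleton]
    refine ⟨fun ⟨a, ha⟩ ⟨b, hb⟩ => ?_⟩
    simp only [Function.mem_fixedPoints, Function.IsFixedPt, Fin.revPerm_apply, Fin.ext_iff,
      Fin.val_rev] at ha hb
    ext
    simp only
    omega
  have hcard := Perm.card_fixedPoints (Fin.revPerm : Perm (Fin n))
  have hle := Finset.card_le_univ (Fin.revPerm : Perm (Fin n)).support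
  have heven : Even (Fin.revPerm : Perm (Fin n)).support.card := by
    rw [even_iff_two_dvd]
    exact Perm.two_dvd_card_support (by ext x; simp [pow_two])
  rw [Perm.sum_cycleType] at hcard
  rw [Fintype.card_fin] at hcard hle ⊢
  congr 1
  rw [even_iff_two_dvd] at heven
  omega

open Equiv in
theorem sign_addRight_of_isUnit {n : ℕ} [NeZero n] {t : ZMod n} (ht : IsUnit t) :
    Perm.sign (Equiv.addRight t) = (-1) ^ (n - 1) := by
  obtain ⟨u, rfl⟩ := ht
  have hconj : Equiv.addRight (u : ZMod n) =
      (u.mulLeft).permCongr (Equiv.addRight (1 : ZMod n)) := by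
    ext x
    simp [mul_add]
  rw [hconj, Perm.sign_permCongr]
  obtain ⟨m, rfl⟩ := Nat.exists_eq_succ_of_ne_zero (NeZero.ne n)
  rw [← sign_finRotate (m + 1)]
  change Perm.sign (α := Fin (m + 1)) _ = _
  congr 1
  ext x : 1
  exact (finRotate_apply x).symm

/-- for `gcd n t.val = 1`, the number `k` of even-length cycles of the R
proliferating permutation is even iff `n % 4 = 1` or `n % 4 = 2`. -/
theorem stmt_16 (n : ℕ) [NeZero n] (t : ZMod n) (ht : Nat.gcd n t.val = 1)
    (s : Fin n ≃ ZMod n) (hs : s 0 = 0)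
    (σ : Equiv.Perm (ZMod n)) (hσ : ∀ x : ZMod n, σ x = s (Fin.rev (s.symm x)) + t)
    (k : ℕ) (hk : k = Multiset.card ((fullCycleType σ).filter fun c => Even c)) :
    Even k ↔ (n % 4 = 1 ∨ n % 4 = 2) := by
  have hunit : IsUnit t := by
    rw [← ZMod.natCast_zmod_val t, ZMod.isUnit_iff_coprime]
    exact Nat.Coprime.symm ht
  have hfac : σ = Equiv.addRight t * s.permCongr Fin.revPerm := by
    ext x
    simp [hσ, Equiv.permCongr_apply]
  have hsign := sign_eq_neg_one_pow_card_filter_even σ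
  rw [← hk, hfac, Equiv.Perm.sign_mul, sign_addRight_of_isUnit hunit, Equiv.Perm.sign_permCongr,
    sign_finRevPerm, ← pow_add] at hsign
  have hn := NeZero.pos n
  rw [← neg_one_pow_eq_one_iff_even (R := ℤˣ) (by decide), ← hsign,
    neg_one_pow_eq_one_iff_even (by decide), Nat.even_iff]
  omega
end
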